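/- Let A be a simple linear arrangement of n hyperplanes in ℝ^d (n ≥ d ≥ 1) with induced d-maximum class C ⊆ {0,1}^n, and let h be an affine hyperplane in ℝ^d such that A together with h is in general position. Then the set C' of sign vectors with respect to A of points of h lying on no hyperplane of A is a (d−1)-maximum class contained in C. -/

import Mathlib

open Finset

namespace GeomCompress

/-- `C` shatters the coordinate set `Y`: every pattern on `Y` is realized by some concept. -/
def Shatters {n : ℕ} (C : Finset (Fin n → Bool)) (Y : Finset (Fin n)) : Prop :=
  ∀ p : Fin n → Bool, ∃ c ∈ C, ∀ i ∈ Y, c i = p i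

/-- The VC dimension of `C` equals `d`. -/
def VCDimEq {n : ℕ} (C : Finset (Fin n → Bool)) (d : ℕ) : Prop :=
  (∃ Y : Finset (Fin n), Y.card = d ∧ Shatters C Y) ∧
    ∀ Y : Finset (Fin n), Shatters C Y → Y.card ≤ d

/-- `C` is a `d`-maximum class: VC dimension `d` and maximum possible cardinality. -/
def IsMaximum {n : ℕ} (C : Finset (Fin n → Bool)) (d : ℕ) : Prop :=
  VCDimEq C d ∧ C.card = ∑ i ∈ Finset.range (d + 1), Nat.choose n i

/-- Hamming distance between two Boolean vectors. -/
def hamming {n : ℕ} (u v : Fin n → Bool) : ℕ :=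
  (Finset.univ.filter fun i => u i ≠ v i).card

/-- Adjacency in the one-inclusion graph: differ in exactly one coordinate. -/
def Adj {n : ℕ} (u v : Fin n → Bool) : Prop := hamming u v = 1

instance {n : ℕ} (u v : Fin n → Bool) : Decidable (Adj u v) := by
  unfold Adj; infer_instance

/-- `Q` is a cube of `C` colored by `I`: a subset of `C` whose elements agree outside `I`
and realize all patterns on `I`. -/
def IsCube {n : ℕ} (C Q : Finset (Fin n → Bool)) (I : Finset (Fin n)) : Prop :=
  Q ⊆ C ∧ (∀ u ∈ Q, ∀ v ∈ Q, ∀ i, i ∉ I → u i = v i) ∧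
    ∀ p : Fin n → Bool, ∃ u ∈ Q, ∀ i ∈ I, u i = p i

/-- `v` is a corner vertex of `C`: there is a unique cube of maximum dimension among all
cubes of `C` containing `v`, and all neighbors of `v` in the one-inclusion graph of `C`
lie in that cube. -/
def IsCorner {n : ℕ} (C : Finset (Fin n → Bool)) (v : Fin n → Bool) : Prop :=
  ∃ Q I, IsCube C Q I ∧ v ∈ Q ∧
    (∀ Q' I', IsCube C Q' I' → v ∈ Q' → I'.card ≤ I.card) ∧
    (∀ Q' I', IsCube C Q' I' → v ∈ Q' → I'.card = I.card → Q' = Q) ∧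
    ∀ u ∈ C, Adj u v → u ∈ Q

/-- The class remaining after peeling the first `t` vertices of the ordering `v`. -/
def Peeled {n m : ℕ} (C : Finset (Fin n → Bool)) (v : Fin m → (Fin n → Bool)) (t : Fin m) :
    Finset (Fin n → Bool) :=
  C \ (Finset.univ.filter fun s : Fin m => s < t).image v

/-- `v` is a corner-peeling ordering of `C`: an enumeration of `C` such that each `v t`
is a corner vertex of the class remaining before step `t`. -/
def IsCornerPeeling {n : ℕ} (C : Finset (Fin n → Bool)) (v : Fin C.card → (Fin n → Bool)) :
    Prop :=
  Function.Injective v ∧ (∀ t, v t ∈ C) ∧ ∀ t, IsCorner (Peeled C v t) (v t)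

/-- Degree of `v` in the one-inclusion graph of `C`. -/
def degreeIn {n : ℕ} (C : Finset (Fin n → Bool)) (v : Fin n → Bool) : ℕ :=
  (C.filter fun u => Adj u v).card

/-- The colors of the edges incident to `v` in the one-inclusion graph of `C`. -/
def incidentColors {n : ℕ} (C : Finset (Fin n → Bool)) (v : Fin n → Bool) : Finset (Fin n) :=
  Finset.univ.filter fun i => ∃ u ∈ C, Adj u v ∧ u i ≠ v i

/-- `C` is shortest-path closed: any two concepts are joined in the one-inclusion graph of
`C` by a path whose length is their Hamming distance. -/
def SPClosed {n : ℕ} (C : Finset (Fin n → Bool)) : Prop :=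
  ∀ u ∈ C, ∀ v ∈ C, ∃ p : ℕ → (Fin n → Bool),
    p 0 = u ∧ p (hamming u v) = v ∧ (∀ k ≤ hamming u v, p k ∈ C) ∧
    ∀ k < hamming u v, Adj (p k) (p (k + 1))

/-- `Q` (colored by `I`, with `I.card = d - 1`) is a cube of the boundary `∂C` of the
`d`-maximum class `C`: it is a face of exactly one `d`-cube of `C`. -/
def IsBoundaryCube {n : ℕ} (C : Finset (Fin n → Bool)) (d : ℕ)
    (Q : Finset (Fin n → Bool)) (I : Finset (Fin n)) : Prop :=
  IsCube C Q I ∧ I.card = d - 1 ∧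
    (∃ Q' I', IsCube C Q' I' ∧ I'.card = d ∧ Q ⊆ Q' ∧ I ⊆ I') ∧
    ∀ Q₁ I₁ Q₂ I₂, IsCube C Q₁ I₁ → I₁.card = d → Q ⊆ Q₁ → I ⊆ I₁ →
      IsCube C Q₂ I₂ → I₂.card = d → Q ⊆ Q₂ → I ⊆ I₂ → Q₁ = Q₂

/-- Standard inner product on `Fin d → ℝ`. -/
def dotR {d : ℕ} (x y : Fin d → ℝ) : ℝ := ∑ i, x i * y i

/-- `x` lies on none of the hyperplanes `⟪a i, ·⟫ = b i`. -/
def OnNoHyperplane {d N : ℕ} (a : Fin N → Fin d → ℝ) (b : Fin N → ℝ) (x : Fin d → ℝ) :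
    Prop :=
  ∀ i, dotR (a i) x ≠ b i

/-- The sign vector of the point `x` with respect to the oriented hyperplanes `(a, b)`. -/
noncomputable def signVec {d N : ℕ} (a : Fin N → Fin d → ℝ) (b : Fin N → ℝ)
    (x : Fin d → ℝ) : Fin N → Bool :=
  fun i => decide (b i < dotR (a i) x)

/-- `C` is the concept class induced by the arrangement `(a, b)`: the set of sign vectors
of points lying on none of the hyperplanes. -/
def IsInducedClass {d N : ℕ} (a : Fin N → Fin d → ℝ) (b : Fin N → ℝ)
    (C : Finset (Fin N → Bool)) : Prop :=
  ∀ c, c ∈ C ↔ ∃ x : Fin d → ℝ, OnNoHyperplane a b x ∧ signVec a b x = c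

/-- A simple linear arrangement in `ℝ^d`: every `≤ d` of the hyperplanes are in general
position (normals linearly independent, so every `k ≤ d` of them intersect in an affine
subspace of dimension `d - k`), and every `d+1` of them have empty common intersection. -/
def SimpleArrangement (d : ℕ) {N : ℕ} (a : Fin N → Fin d → ℝ) (b : Fin N → ℝ) : Prop :=
  (∀ S : Finset (Fin N), S.card ≤ d → LinearIndependent ℝ (fun i : S => a i.1)) ∧
    ∀ S : Finset (Fin N), S.card = d + 1 → ¬∃ x : Fin d → ℝ, ∀ i ∈ S, dotR (a i) x = b i

/-- Membership in the open unit ball (Klein model of hyperbolic space `H^k`). -/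
def inBall {k : ℕ} (x : Fin k → ℝ) : Prop := ∑ i, x i ^ 2 < 1

/-- A simple hyperbolic `d`-arrangement in the Klein model `H^k`: every `d` of the
hyperplanes intersect inside the unit ball in a `(k-d)`-dimensional hyperbolic plane
(normals independent and common point inside the ball), and every `d+1` of them have
empty common intersection inside the ball. -/
def SimpleHyperbolicArrangement (d : ℕ) {k N : ℕ} (a : Fin N → Fin k → ℝ)
    (b : Fin N → ℝ) : Prop :=
  (∀ S : Finset (Fin N), S.card = d →
      LinearIndependent ℝ (fun i : S => a i.1) ∧
        ∃ x : Fin k → ℝ, inBall x ∧ ∀ i ∈ S, dotR (a i) x = b i) ∧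
    ∀ S : Finset (Fin N), S.card = d + 1 →
      ¬∃ x : Fin k → ℝ, inBall x ∧ ∀ i ∈ S, dotR (a i) x = b i

/-- The concept class induced by a hyperbolic arrangement: sign vectors of points of the
open unit ball lying on none of the hyperplanes. -/
def IsInducedClassH {k N : ℕ} (a : Fin N → Fin k → ℝ) (b : Fin N → ℝ)
    (C : Finset (Fin N → Bool)) : Prop :=
  ∀ c, c ∈ C ↔ ∃ x : Fin k → ℝ, inBall x ∧ OnNoHyperplane a b x ∧ signVec a b x = c

/-- A generic arrangement of oriented affine hyperplanes in `ℝ^n`: every subcollection of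
`k` hyperplanes, `2 ≤ k ≤ n`, either has empty common intersection or intersects
transversely (normals linearly independent, giving an affine subspace of dim `n - k`). -/
def GenericArrangement {n N : ℕ} (a : Fin N → Fin n → ℝ) (b : Fin N → ℝ) : Prop :=
  ∀ S : Finset (Fin N), 2 ≤ S.card → S.card ≤ n →
    (¬∃ x : Fin n → ℝ, ∀ i ∈ S, dotR (a i) x = b i) ∨
      LinearIndependent ℝ (fun i : S => a i.1)

/-- `C` is a maximal class of VC dimension `d`: adding any new concept increases the VC
dimension. -/
def IsMaximalClass {n : ℕ} (C : Finset (Fin n → Bool)) (d : ℕ) : Prop :=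
  VCDimEq C d ∧
    ∀ c : Fin n → Bool, c ∉ C →
      ∃ Y : Finset (Fin n), d < Y.card ∧ Shatters (insert c C) Y

/-- A path in the one-inclusion graph of `C` avoiding `C'`, from a vertex of `Q1` to a
vertex of `Q2`. -/
def CConnPath {n : ℕ} (C C' Q1 Q2 : Finset (Fin n → Bool)) : Prop :=
  ∃ (L : ℕ) (p : ℕ → Fin n → Bool),
    p 0 ∈ Q1 ∧ p L ∈ Q2 ∧ (∀ j ≤ L, p j ∈ C ∧ p j ∉ C') ∧
      ∀ j < L, Adj (p j) (p (j + 1))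

/-- `Q1` and `Q2` are `d`-cubes of `C` joined by a path of the one-inclusion graph of `C`
avoiding `C'`. -/
def CComponentRel {n : ℕ} (C C' : Finset (Fin n → Bool)) (d : ℕ)
    (Q1 Q2 : Finset (Fin n → Bool)) : Prop :=
  (∃ I, IsCube C Q1 I ∧ I.card = d) ∧ (∃ I, IsCube C Q2 I ∧ I.card = d) ∧
    CConnPath C C' Q1 Q2

/-- `Comp` enumerates the `C'`-connected components of `C`: each component is a union of
`d`-cubes of `C`, every `d`-cube lies in exactly one component, and two `d`-cubes lie in
the same component iff they are related under the transitive closure of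
`C'`-connectedness. -/
def IsComponents {n : ℕ} (C C' : Finset (Fin n → Bool)) (d : ℕ) {k : ℕ}
    (Comp : Fin k → Finset (Fin n → Bool)) : Prop :=
  (∀ q, ∀ x ∈ Comp q, ∃ Q I, IsCube C Q I ∧ I.card = d ∧ x ∈ Q ∧ Q ⊆ Comp q) ∧
  (∀ Q I, IsCube C Q I → I.card = d → ∃ q, Q ⊆ Comp q) ∧
  (∀ q q' Q I, IsCube C Q I → I.card = d → Q ⊆ Comp q → Q ⊆ Comp q' → q = q') ∧
  ∀ q Q1 I1, IsCube C Q1 I1 → I1.card = d → Q1 ⊆ Comp q →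
    ∀ Q2 I2, IsCube C Q2 I2 → I2.card = d →
      (Q2 ⊆ Comp q ↔ Relation.TransGen (CComponentRel C C' d) Q1 Q2)

/-- Append the bit `b` as a new last coordinate. -/
def app {n : ℕ} (c : Fin n → Bool) (b : Bool) : Fin (n + 1) → Bool := Fin.snoc c b

/-- The lift `(C' × {0,1}) ∪ ⋃_q (Comp q × {p q})`. -/
def LiftClass {n k : ℕ} (C' : Finset (Fin n → Bool))
    (Comp : Fin k → Finset (Fin n → Bool)) (p : Fin k → Bool) :
    Finset (Fin (n + 1) → Bool) :=
  C'.image (fun c => app c false) ∪ C'.image (fun c => app c true) ∪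
    Finset.univ.biUnion fun q => (Comp q).image fun c => app c (p q)

/-- Boolean vectors correspond to their supports. -/
def supportEquiv (n : ℕ) : (Fin n → Bool) ≃ Finset (Fin n) where
  toFun c := Finset.univ.filter fun i => c i = true
  invFun s := fun i => decide (i ∈ s)
  left_inv c := by ext i; simp
  right_inv s := by ext i; simp

theorem mem_supportEquiv {n : ℕ} (c : Fin n → Bool) (i : Fin n) :
    i ∈ supportEquiv n c ↔ c i = true := by
  simp [supportEquiv]

theorem shatters_map_supportEquiv {n : ℕ} (C : Finset (Fin n → Bool)) (Y : Finset (Fin n)) :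
    (C.map (supportEquiv n).toEmbedding).Shatters Y ↔ Shatters C Y := by
  constructor
  · intro h p
    obtain ⟨u, hu, hY⟩ := h (Finset.filter_subset (fun i => p i = true) Y)
    obtain ⟨c, hc, rfl⟩ := Finset.mem_map.1 hu
    refine ⟨c, hc, fun i hi => ?_⟩
    have := congrArg (i ∈ ·) hY
    simp only [Equiv.coe_toEmbedding, Finset.mem_inter, mem_supportEquiv, Finset.mem_filter, hi,
      true_and, eq_iff_iff] at this
    exact Bool.eq_iff_iff.2 this
  · intro h t ht
    obtain ⟨c, hc, hY⟩ := h fun i => decide (i ∈ t)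
    refine ⟨supportEquiv n c, Finset.mem_map_of_mem _ hc, ?_⟩
    ext i
    rw [Finset.mem_inter, mem_supportEquiv]
    constructor
    · rintro ⟨hi, hci⟩
      simpa [hY i hi] using hci
    · intro hi
      exact ⟨ht hi, by simpa [hY i (ht hi)] using hi⟩

open Classical in
/-- Pajor's inequality for classes of Boolean vectors. -/
theorem card_le_card_shattered {n : ℕ} (C : Finset (Fin n → Bool)) :
    C.card ≤ (Finset.univ.filter fun Y => Shatters C Y).card := by
  have h := Finset.card_le_card_shatterer (C.map (supportEquiv n).toEmbedding)
  rw [Finset.card_map] at h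
  refine h.trans (Finset.card_le_card fun Y hY => ?_)
  simpa using (shatters_map_supportEquiv C Y).1 (Finset.mem_shatterer.1 hY)

/-- `C` strongly shatters `Y`: it contains a whole cube colored by `Y`. -/
def StronglyShatters {n : ℕ} (C : Finset (Fin n → Bool)) (Y : Finset (Fin n)) : Prop :=
  ∃ q : Fin n → Bool, ∀ c : Fin n → Bool, (∀ i ∉ Y, c i = q i) → c ∈ C

theorem StronglyShatters.mono {n : ℕ} {C : Finset (Fin n → Bool)} {Y Z : Finset (Fin n)}
    (h : StronglyShatters C Z) (hYZ : Y ⊆ Z) : StronglyShatters C Y := by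
  obtain ⟨q, hq⟩ := h
  exact ⟨q, fun c hc => hq c fun i hi => hc i fun hY => hi (hYZ hY)⟩

theorem StronglyShatters.shatters {n : ℕ} {C : Finset (Fin n → Bool)} {Y : Finset (Fin n)}
    (h : StronglyShatters C Y) : Shatters C Y := by
  obtain ⟨q, hq⟩ := h
  intro p
  exact ⟨fun i => if i ∈ Y then p i else q i, hq _ fun i hi => by simp [hi],
    fun i hi => by simp [hi]⟩

theorem StronglyShatters.not_shatters_compl {n : ℕ} {C : Finset (Fin n → Bool)}
    {Y : Finset (Fin n)} (h : StronglyShatters C Y) : ¬Shatters Cᶜ Yᶜ := by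
  obtain ⟨q, hq⟩ := h
  intro hs
  obtain ⟨c, hc, hcq⟩ := hs q
  exact Finset.mem_compl.1 hc (hq c fun i hi => hcq i (Finset.mem_compl.2 hi))

open Classical in
/-- The reverse Pajor inequality: a class is at least as large as the number of
coordinate sets it strongly shatters. -/
theorem card_stronglyShattered_le_card {n : ℕ} (C : Finset (Fin n → Bool)) :
    (Finset.univ.filter fun Y => StronglyShatters C Y).card ≤ C.card := by
  have h1 := card_le_card_shattered Cᶜ
  have h2 : (Finset.univ.filter fun Y => StronglyShatters C Y).card ≤
      (Finset.univ.filter fun Y => ¬Shatters Cᶜ Y).card :=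
    Finset.card_le_card_of_injOn (fun Y => Yᶜ)
      (fun Y hY => by
        simpa using StronglyShatters.not_shatters_compl (by simpa using hY))
      compl_injective.injOn
  have h3 := Finset.card_filter_add_card_filter_not (s := Finset.univ)
    (fun Y : Finset (Fin n) => Shatters Cᶜ Y)
  have h4 := Finset.card_add_card_compl C
  simp only [Finset.card_univ, Fintype.card_finset, Fintype.card_pi, Fintype.card_bool,
    Finset.prod_const, Fintype.card_fin] at h3 h4
  omega

theorem card_filter_card_le (n k : ℕ) :
    (Finset.univ.filter fun Y : Finset (Fin n) => Y.card ≤ k).card =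
      ∑ i ∈ Finset.range (k + 1), Nat.choose n i := by
  rw [Finset.card_eq_sum_card_fiberwise (f := Finset.card) (t := Finset.range (k + 1))]
  · refine Finset.sum_congr rfl fun i hi => ?_
    have h := Finset.card_powersetCard i (Finset.univ : Finset (Fin n))
    rw [Finset.card_univ, Fintype.card_fin] at h
    rw [← h]
    congr 1
    ext Y
    simp only [Finset.mem_range] at hi
    simp only [Finset.mem_filter, Finset.mem_univ, true_and, Finset.mem_powersetCard,
      Finset.subset_univ]
    omega
  · intro Y hY
    simp at hY ⊢
    omega

/-- A class strongly shattering every `k`-set and shattering no `(k+1)`-set is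
`k`-maximum. -/
theorem isMaximum_of_stronglyShatters {n k : ℕ} (hk : k ≤ n) {C : Finset (Fin n → Bool)}
    (hcube : ∀ Y : Finset (Fin n), Y.card = k → StronglyShatters C Y)
    (hnot : ∀ Y : Finset (Fin n), Y.card = k + 1 → ¬Shatters C Y) : IsMaximum C k := by
  classical
  have hle : ∀ Y : Finset (Fin n), Shatters C Y → Y.card ≤ k := by
    intro Y hY
    by_contra! hlt
    obtain ⟨Z, hZY, hZ⟩ := Finset.exists_subset_card_eq (Nat.succ_le_of_lt hlt)
    refine hnot Z hZ fun p => ?_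
    obtain ⟨c, hc, hcp⟩ := hY p
    exact ⟨c, hc, fun i hi => hcp i (hZY hi)⟩
  refine ⟨⟨?_, hle⟩, le_antisymm ?_ ?_⟩
  · obtain ⟨Y, -, hY⟩ := Finset.exists_subset_card_eq
      (s := (Finset.univ : Finset (Fin n))) (n := k) (by simpa using hk)
    exact ⟨Y, hY, (hcube Y hY).shatters⟩
  · rw [← card_filter_card_le]
    refine (card_le_card_shattered C).trans (Finset.card_le_card fun Y hY => ?_)
    simpa using hle Y (by simpa using hY)
  · rw [← card_filter_card_le]
    refine le_trans (Finset.card_le_card fun Y hY => ?_) (card_stronglyShattered_le_card C)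
    obtain ⟨Z, hYZ, hZ⟩ := Finset.exists_superset_card_eq (s := Y) (n := k)
      (by simpa using hY) (by simpa using hk)
    simpa using (hcube Z hZ).mono hYZ

theorem exists_dotR_eq {d N : ℕ} {a : Fin N → Fin d → ℝ} {S : Finset (Fin N)}
    (h : LinearIndependent ℝ (fun i : S => a i.1)) (y : Fin N → ℝ) :
    ∃ x : Fin d → ℝ, ∀ i ∈ S, dotR (a i) x = y i := by
  let M : Matrix S (Fin d) ℝ := Matrix.of fun i => a i.1
  have hM : LinearIndependent ℝ M.row := h
  have htop : LinearMap.range M.mulVecLin = ⊤ := by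
    apply Submodule.eq_top_of_finrank_eq
    have := hM.rank_matrix
    rw [Matrix.rank] at this
    rw [this, Module.finrank_fintype_fun_eq_card]
  obtain ⟨x, hx⟩ := LinearMap.range_eq_top.1 htop fun i => y i.1
  exact ⟨x, fun i hi => congrFun hx ⟨i, hi⟩⟩

theorem dotR_add_smul {d : ℕ} (u x v : Fin d → ℝ) (t : ℝ) :
    dotR u (x + t • v) = dotR u x + t * dotR u v := by
  simp only [dotR, Pi.add_apply, Pi.smul_apply, smul_eq_mul, Finset.mul_sum,
    ← Finset.sum_add_distrib]
  exact Finset.sum_congr rfl fun i _ => by ring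

theorem exists_eq_sum_dotR {d N : ℕ} {a : Fin N → Fin d → ℝ} {S : Finset (Fin N)}
    (hS : S.card = d) (h : LinearIndependent ℝ (fun i : S => a i.1)) (g : Fin d → ℝ) :
    ∃ c : S → ℝ, ∀ x, dotR g x = ∑ i, c i * dotR (a i.1) x := by
  have hspan := h.span_eq_top_of_card_eq_finrank' (by simp [hS])
  obtain ⟨c, hc⟩ := (Submodule.mem_span_range_iff_exists_fun ℝ).1
    (hspan ▸ Submodule.mem_top : g ∈ Submodule.span ℝ (Set.range fun i : S => a i.1))
  refine ⟨c, fun x => ?_⟩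
  simp only [← hc, dotR, Finset.sum_apply, Pi.smul_apply, smul_eq_mul, Finset.sum_mul,
    Finset.mul_sum, mul_assoc]
  exact Finset.sum_comm

/-- The hyperplanes indexed by `Y` together with the last one. -/
def consLast {n : ℕ} (Y : Finset (Fin n)) : Finset (Fin (n + 1)) :=
  Finset.cons (Fin.last n) (Y.map Fin.castSuccEmb) (by simp)

theorem card_consLast {n : ℕ} (Y : Finset (Fin n)) : (consLast Y).card = Y.card + 1 := by
  simp [consLast]

theorem forall_mem_consLast {n : ℕ} {Y : Finset (Fin n)} {P : Fin (n + 1) → Prop} :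
    (∀ i ∈ consLast Y, P i) ↔ P (Fin.last n) ∧ ∀ i ∈ Y, P i.castSucc := by
  simp [consLast]

theorem not_shatters_hyperplane_section {d n : ℕ} {a : Fin n → Fin d → ℝ} {b : Fin n → ℝ}
    (hA : SimpleArrangement d a b) {g : Fin d → ℝ} {e : ℝ}
    (hgen : SimpleArrangement d (Fin.snoc a g : Fin (n + 1) → Fin d → ℝ)
      (Fin.snoc b e : Fin (n + 1) → ℝ))
    {C : Finset (Fin n → Bool)}
    (hC : ∀ c ∈ C, ∃ x : Fin d → ℝ, dotR g x = e ∧ signVec a b x = c)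
    {Y : Finset (Fin n)} (hY : Y.card = d) : ¬Shatters C Y := by
  classical
  intro hs
  have hli := hA.1 Y hY.le
  obtain ⟨p, hp⟩ := exists_dotR_eq hli b
  have hgp : dotR g p ≠ e := by
    intro h
    refine hgen.2 (consLast Y) (by rw [card_consLast, hY]) ⟨p, ?_⟩
    rw [forall_mem_consLast]
    simpa using ⟨h, hp⟩
  obtain ⟨w, hw⟩ := exists_eq_sum_dotR hY hli g
  obtain ⟨c, hc, hcY⟩ := hs fun i =>
    decide (∃ hi : i ∈ Y, w ⟨i, hi⟩ * (e - dotR g p) < 0)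
  obtain ⟨x, hx, rfl⟩ := hC c hc
  have hsum : (e - dotR g p) * (e - dotR g p) =
      ∑ i : Y, w i * (e - dotR g p) * (dotR (a i.1) x - b i.1) := by
    have h : e - dotR g p = ∑ i : Y, w i * (dotR (a i.1) x - b i.1) := by
      rw [← hx, hw x, hw p, ← Finset.sum_sub_distrib]
      exact Finset.sum_congr rfl fun i _ => by rw [hp i.1 i.2]; ring
    conv_lhs => rw [mul_comm]; arg 1; rw [h]
    rw [Finset.sum_mul]
    exact Finset.sum_congr rfl fun i _ => by ring
  have hpos : 0 < (e - dotR g p) * (e - dotR g p) :=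
    mul_self_pos.2 (sub_ne_zero.2 hgp.symm)
  refine absurd (hsum ▸ hpos) (not_lt.2 (Finset.sum_nonpos fun i _ => ?_))
  have hi := hcY i.1 i.2
  simp only [signVec, decide_eq_decide, i.2, exists_true_left] at hi
  by_cases hneg : w i * (e - dotR g p) < 0
  · exact mul_nonpos_of_nonpos_of_nonneg hneg.le (sub_nonneg.2 (hi.2 hneg).le)
  · exact mul_nonpos_of_nonneg_of_nonpos (not_lt.1 hneg)
      (sub_nonpos.2 (not_lt.1 fun h => hneg (hi.1 h)))

theorem stronglyShatters_hyperplane_section {d n : ℕ} {a : Fin n → Fin d → ℝ} {b : Fin n → ℝ}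
    {g : Fin d → ℝ} {e : ℝ}
    (hgen : SimpleArrangement d (Fin.snoc a g : Fin (n + 1) → Fin d → ℝ)
      (Fin.snoc b e : Fin (n + 1) → ℝ))
    {C : Finset (Fin n → Bool)}
    (hC : ∀ x : Fin d → ℝ, dotR g x = e → OnNoHyperplane a b x → signVec a b x ∈ C)
    {Y : Finset (Fin n)} (hY : Y.card + 1 = d) : StronglyShatters C Y := by
  have hli := hgen.1 (consLast Y) (by rw [card_consLast, hY])
  obtain ⟨x, hx⟩ := exists_dotR_eq hli (Fin.snoc b e : Fin (n + 1) → ℝ)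
  have hx' := forall_mem_consLast.1 hx
  simp only [Fin.snoc_last, Fin.snoc_castSucc] at hx'
  have hoff : ∀ j ∉ Y, dotR (a j) x ≠ b j := by
    intro j hj h
    refine hgen.2 (consLast (Finset.cons j Y hj)) 
      (by rw [card_consLast, Finset.card_cons, hY]) ⟨x, ?_⟩
    rw [forall_mem_consLast]
    simpa using ⟨hx'.1, h, hx'.2⟩
  refine ⟨signVec a b x, fun c hc => ?_⟩
  obtain ⟨v, hv⟩ := exists_dotR_eq hli
    (Fin.snoc (fun i => if c i = true then 1 else -1) 0 : Fin (n + 1) → ℝ)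
  have hv' := forall_mem_consLast.1 hv
  simp only [Fin.snoc_last, Fin.snoc_castSucc] at hv'
  have hev : ∀ᶠ t : ℝ in nhdsWithin 0 (Set.Ioi 0), ∀ i,
      dotR (a i) (x + t • v) ≠ b i ∧ (b i < dotR (a i) (x + t • v) ↔ c i = true) := by
    rw [Filter.eventually_all]
    intro i
    simp only [dotR_add_smul]
    by_cases hi : i ∈ Y
    · filter_upwards [self_mem_nhdsWithin] with t ht
      have ht' : 0 < t := ht
      rw [hx'.2 i hi, hv'.2 i hi]
      by_cases hci : c i = true
      · simp [hci, ht', ht'.ne']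
      · simp [hci, ht'.le, ht'.ne']
    · have hcont : Filter.Tendsto (fun t : ℝ => dotR (a i) x + t * dotR (a i) v)
          (nhdsWithin 0 (Set.Ioi 0)) (nhds (dotR (a i) x)) := by
        have : Continuous fun t : ℝ => dotR (a i) x + t * dotR (a i) v := by fun_prop
        simpa using (this.tendsto 0).mono_left nhdsWithin_le_nhds
      rw [hc i hi]
      rcases lt_or_gt_of_ne (hoff i hi) with hlt | hgt
      · filter_upwards [hcont.eventually_lt_const hlt] with t ht
        exact ⟨ht.ne, by simp [signVec, ht.not_gt, hlt.not_gt]⟩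
      · filter_upwards [hcont.eventually_const_lt hgt] with t ht
        exact ⟨ht.ne', by simp [signVec, ht, hgt]⟩
  obtain ⟨t, ht⟩ := hev.exists
  have hmem := hC (x + t • v) (by rw [dotR_add_smul, hx'.1, hv'.1]; simp) fun i => (ht i).1
  convert hmem using 1
  funext i
  rw [Bool.eq_iff_iff, signVec, decide_eq_true_iff, (ht i).2]

/-- Let `A` be a simple linear arrangement of `n` hyperplanes in `ℝ^d`
(`n ≥ d ≥ 1`) with induced `d`-maximum class `C`, and let `h = {x | ⟪g, x⟫ = e}` be a
hyperplane such that `A` together with `h` is in general position. Then the class `C'` of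
sign vectors (w.r.t. `A`) of points of `h` on no hyperplane of `A` is `(d-1)`-maximum and
contained in `C`. -/
theorem stmt7 (d n : ℕ) (hd : 1 ≤ d) (hdn : d ≤ n)
    (a : Fin n → Fin d → ℝ) (b : Fin n → ℝ) (hA : SimpleArrangement d a b)
    (g : Fin d → ℝ) (e : ℝ)
    (hgen : SimpleArrangement d (Fin.snoc a g) (Fin.snoc b e))
    (C : Finset (Fin n → Bool)) (hC : IsInducedClass a b C)
    (C' : Finset (Fin n → Bool))
    (hC' : ∀ c, c ∈ C' ↔
      ∃ x : Fin d → ℝ, dotR g x = e ∧ OnNoHyperplane a b x ∧ signVec a b x = c) :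
    IsMaximum C' (d - 1) ∧ C' ⊆ C := by
  obtain ⟨k, rfl⟩ := Nat.exists_eq_add_of_le' hd
  refine ⟨isMaximum_of_stronglyShatters (by omega) (fun Y hY => ?_) (fun Y hY => ?_),
    fun c hc => ?_⟩
  · exact stronglyShatters_hyperplane_section hgen
      (fun x hx hoff => (hC' _).2 ⟨x, hx, hoff, rfl⟩) (by omega)
  · refine not_shatters_hyperplane_section hA hgen (fun c hc => ?_) (by omega)
    obtain ⟨x, hx, -, hc⟩ := (hC' c).1 hc
    exact ⟨x, hx, hc⟩
  · obtain ⟨x, -, hx⟩ := (hC' c).1 hc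
    exact (hC c).2 ⟨x, hx⟩

end GeomCompress
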